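/- Let α ∈ ℝ, 0 < p < ∞, 1 < r < ∞ and 1 ≤ q < ∞, with −n/r < α < n/r' (where 1/r + 1/r' = 1). Then the Hardy–Littlewood maximal operator M is bounded on the Herz–Lorentz space K̇^{α,p}_{r,q}(ℝⁿ): there is C > 0 such that every f with ‖f‖_{K̇^{α,p}_{r,q}} < ∞ is locally integrable and ‖Mf‖_{K̇^{α,p}_{r,q}} ≤ C‖f‖_{K̇^{α,p}_{r,q}}. -/

import Mathlib

open MeasureTheory ENNReal Set Filter
open scoped NNReal Topology

noncomputable section

/-- Euclidean space `ℝⁿ`. -/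
abbrev Euc (n : ℕ) := EuclideanSpace ℝ (Fin n)

/-- The dyadic annulus `C_k = B(0,2^k) \ B(0,2^{k-1})`. -/
def annulus (n : ℕ) (k : ℤ) : Set (Euc n) :=
  Metric.ball (0 : Euc n) ((2 : ℝ) ^ k) \ Metric.ball (0 : Euc n) ((2 : ℝ) ^ (k - 1))

/-- The Hardy–Littlewood maximal operator, acting on nonnegative extended-real-valued
functions (representing `|f|`): `Mf(x) = sup_{B ∋ x} |B|⁻¹ ∫_B f`. -/
def maximalFn {n : ℕ} (f : Euc n → ℝ≥0∞) (x : Euc n) : ℝ≥0∞ :=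
  ⨆ (c : Euc n) (r : ℝ) (_ : 0 < r) (_ : x ∈ Metric.ball c r),
    (volume (Metric.ball c r))⁻¹ * ∫⁻ y in Metric.ball c r, f y ∂volume

/-- A ball Banach function space on `ℝⁿ`, encoded by its norm functional `N`,
defined on all nonnegative extended-real-valued measurable functions (a real measurable
function `f` has norm `N (fun x => ‖f x‖₊)`). -/
structure BallBFS (n : ℕ) where
  N : (Euc n → ℝ≥0∞) → ℝ≥0∞
  norm_zero_iff : ∀ f : Euc n → ℝ≥0∞, Measurable f → (N f = 0 ↔ f =ᵐ[volume] 0)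
  norm_mono : ∀ f g : Euc n → ℝ≥0∞, (∀ᵐ x ∂volume, g x ≤ f x) → N g ≤ N f
  norm_isup : ∀ f : ℕ → Euc n → ℝ≥0∞, (∀ m, ∀ᵐ x ∂volume, f m x ≤ f (m + 1) x) →
    N (fun x => ⨆ m, f m x) = ⨆ m, N (f m)
  ball_mem : ∀ (x : Euc n) (r : ℝ), 0 < r → N ((Metric.ball x r).indicator 1) < ∞
  norm_add : ∀ f g : Euc n → ℝ≥0∞, N (fun x => f x + g x) ≤ N f + N g
  ball_integral : ∀ (x : Euc n) (r : ℝ), 0 < r → ∃ C : ℝ≥0∞, 0 < C ∧ C < ∞ ∧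
    ∀ f : Euc n → ℝ≥0∞, N f < ∞ → ∫⁻ y in Metric.ball x r, f y ∂volume ≤ C * N f

/-- The associate ("Köthe dual") norm of a norm functional `N`:
`‖g‖_{X'} = sup { ∫ f·g : ‖f‖_X ≤ 1 }`. -/
def assocN {n : ℕ} (N : (Euc n → ℝ≥0∞) → ℝ≥0∞) (g : Euc n → ℝ≥0∞) : ℝ≥0∞ :=
  ⨆ (f : Euc n → ℝ≥0∞) (_ : Measurable f) (_ : N f ≤ 1), ∫⁻ x, f x * g x ∂volume

/-- The homogeneous Herz-type quasinorm associated with a norm functional `N`,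
for a finite exponent `0 < p < ∞`:
`‖f‖ = (Σ_{k∈ℤ} 2^{kpα} ‖f χ_k‖_X ^ p)^{1/p}`. -/
def herzNorm {n : ℕ} (N : (Euc n → ℝ≥0∞) → ℝ≥0∞) (α p : ℝ) (f : Euc n → ℝ≥0∞) : ℝ≥0∞ :=
  (∑' k : ℤ, (2 : ℝ≥0∞) ^ ((k : ℝ) * p * α) * (N ((annulus n k).indicator f)) ^ p) ^ (1 / p)

/-- The homogeneous Herz-type quasinorm, with exponent `p ∈ (0,∞]`
(for `p = ∞` the sum is replaced by a supremum). -/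
def herzNormE {n : ℕ} (N : (Euc n → ℝ≥0∞) → ℝ≥0∞) (α : ℝ) (p : ℝ≥0∞)
    (f : Euc n → ℝ≥0∞) : ℝ≥0∞ :=
  if p = ∞ then ⨆ k : ℤ, (2 : ℝ≥0∞) ^ ((k : ℝ) * α) * N ((annulus n k).indicator f)
  else herzNorm N α p.toReal f

/-- The decreasing rearrangement `f*(t) = inf { s : |{x : |f(x)| > s}| ≤ t }` of a
nonnegative extended-real-valued function `f` (representing `|f|`). -/
def rearrangement {n : ℕ} (f : Euc n → ℝ≥0∞) (t : ℝ) : ℝ≥0∞ :=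
  ⨅ (s : ℝ≥0∞) (_ : volume {x : Euc n | s < f x} ≤ ENNReal.ofReal t), s

/-- The Lorentz quasinorm `‖f‖_{L^{r,q}} = (∫_0^∞ (t^{1/r} f*(t))^q dt/t)^{1/q}`. -/
def lorentzNorm {n : ℕ} (r q : ℝ) (f : Euc n → ℝ≥0∞) : ℝ≥0∞ :=
  (∫⁻ t in Set.Ioi (0 : ℝ),
      (ENNReal.ofReal (t ^ (1 / r)) * rearrangement f t) ^ q / ENNReal.ofReal t
    ∂volume) ^ (1 / q)

/-- The Herz quasinorm of a real-valued function (finite exponent `p`). -/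
def herzR {n : ℕ} (N : (Euc n → ℝ≥0∞) → ℝ≥0∞) (α p : ℝ) (f : Euc n → ℝ) : ℝ≥0∞ :=
  herzNorm N α p (fun x => (‖f x‖₊ : ℝ≥0∞))

lemma two_rpow_add (x y : ℝ) : (2 : ℝ≥0∞) ^ (x + y) = 2 ^ x * 2 ^ y :=
  ENNReal.rpow_add x y two_ne_zero ofNat_ne_top

lemma two_rpow_ne_zero (x : ℝ) : (2 : ℝ≥0∞) ^ x ≠ 0 := by simp

lemma two_rpow_ne_top (x : ℝ) : (2 : ℝ≥0∞) ^ x ≠ ∞ := by simp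

lemma two_rpow_eq_ofReal (x : ℝ) : (2 : ℝ≥0∞) ^ x = ENNReal.ofReal ((2 : ℝ) ^ x) := by
  rw [← ENNReal.ofReal_rpow_of_pos two_pos]
  simp

lemma two_rpow_le_two_rpow {x y : ℝ} (h : x ≤ y) : (2 : ℝ≥0∞) ^ x ≤ 2 ^ y :=
  ENNReal.rpow_le_rpow_of_exponent_le one_le_two h

lemma summable_two_rpow_neg_abs {δ : ℝ} (hδ : 0 < δ) :
    Summable fun m : ℤ => (2 : ℝ) ^ (-δ * |(m : ℝ)|) := by
  have h : Summable fun m : ℕ => ((2 : ℝ) ^ (-δ)) ^ m :=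
    summable_geometric_of_lt_one (by positivity)
      (Real.rpow_lt_one_of_one_lt_of_neg one_lt_two (by linarith))
  have h' : Summable fun m : ℕ => (2 : ℝ) ^ (-δ * (m : ℝ)) := by
    refine h.congr fun m => ?_
    rw [Real.rpow_mul two_pos.le, Real.rpow_natCast]
  refine Summable.of_nat_of_neg ?_ ?_ <;> simpa using h'

lemma tsum_two_rpow_neg_abs_ne_top {δ : ℝ} (hδ : 0 < δ) :
    ∑' m : ℤ, (2 : ℝ≥0∞) ^ (-δ * |(m : ℝ)|) ≠ ∞ := by
  simp_rw [two_rpow_eq_ofReal]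
  exact (summable_two_rpow_neg_abs hδ).tsum_ofReal_ne_top

/-- Convolution with `2 ^ (-δ |m|)` is bounded on `ℓ^p(ℤ)` for every `0 < p < ∞`. -/
lemma exists_tsum_conv_rpow_le {δ p : ℝ} (hδ : 0 < δ) (hp : 0 < p) :
    ∃ C : ℝ≥0∞, C ≠ ∞ ∧ ∀ a : ℤ → ℝ≥0∞,
      ∑' k : ℤ, (∑' j : ℤ, (2 : ℝ≥0∞) ^ (-δ * |((j - k : ℤ) : ℝ)|) * a j) ^ p
        ≤ C * ∑' j : ℤ, a j ^ p := by
  set W : ℝ → ℝ≥0∞ := fun δ => ∑' m : ℤ, (2 : ℝ≥0∞) ^ (-δ * |(m : ℝ)|)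
  refine ⟨W (δ / 2) ^ p * W (δ / 2 * p), ENNReal.mul_ne_top
    (ENNReal.rpow_ne_top_of_nonneg hp.le (tsum_two_rpow_neg_abs_ne_top (by positivity)))
    (tsum_two_rpow_neg_abs_ne_top (by positivity)), fun a => ?_⟩
  have key : ∀ k : ℤ, (∑' j : ℤ, (2 : ℝ≥0∞) ^ (-δ * |((j - k : ℤ) : ℝ)|) * a j) ^ p
      ≤ W (δ / 2) ^ p * ∑' j : ℤ, (2 : ℝ≥0∞) ^ (-(δ / 2 * p) * |((j - k : ℤ) : ℝ)|) * a j ^ p := by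
    intro k
    set S := ∑' j : ℤ, (2 : ℝ≥0∞) ^ (-(δ / 2 * p) * |((j - k : ℤ) : ℝ)|) * a j ^ p
    have h1 : ∀ j : ℤ, (2 : ℝ≥0∞) ^ (-(δ / 2) * |((j - k : ℤ) : ℝ)|) * a j ≤ S ^ (1 / p) := by
      intro j
      rw [one_div, ENNReal.le_rpow_inv_iff hp, ENNReal.mul_rpow_of_nonneg _ _ hp.le,
        ← ENNReal.rpow_mul]
      refine le_trans (le_of_eq ?_) (ENNReal.le_tsum j)
      congr 2
      ring
    have h2 : ∑' j : ℤ, (2 : ℝ≥0∞) ^ (-δ * |((j - k : ℤ) : ℝ)|) * a j ≤ W (δ / 2) * S ^ (1 / p) := by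
      calc ∑' j : ℤ, (2 : ℝ≥0∞) ^ (-δ * |((j - k : ℤ) : ℝ)|) * a j
          ≤ ∑' j : ℤ, (2 : ℝ≥0∞) ^ (-(δ / 2) * |((j - k : ℤ) : ℝ)|) * S ^ (1 / p) := by
            refine ENNReal.tsum_le_tsum fun j => ?_
            refine le_trans (le_of_eq ?_) (mul_le_mul_right (h1 j) _)
            rw [← mul_assoc, ← two_rpow_add]
            congr 2
            ring
        _ = W (δ / 2) * S ^ (1 / p) := by
            rw [ENNReal.tsum_mul_right]
            congr 1
            exact (Equiv.subRight k).tsum_eq fun m : ℤ => (2 : ℝ≥0∞) ^ (-(δ / 2) * |(m : ℝ)|)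
    calc _ ≤ (W (δ / 2) * S ^ (1 / p)) ^ p := ENNReal.rpow_le_rpow h2 hp.le
      _ = W (δ / 2) ^ p * S := by
        rw [ENNReal.mul_rpow_of_nonneg _ _ hp.le, ← ENNReal.rpow_mul, one_div_mul_cancel hp.ne',
          ENNReal.rpow_one]
  calc _ ≤ ∑' k : ℤ, W (δ / 2) ^ p *
        ∑' j : ℤ, (2 : ℝ≥0∞) ^ (-(δ / 2 * p) * |((j - k : ℤ) : ℝ)|) * a j ^ p :=
        ENNReal.tsum_le_tsum key
    _ = W (δ / 2) ^ p * ∑' j : ℤ, ∑' k : ℤ,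
          (2 : ℝ≥0∞) ^ (-(δ / 2 * p) * |((j - k : ℤ) : ℝ)|) * a j ^ p := by
        rw [ENNReal.tsum_mul_left, ENNReal.tsum_comm]
    _ = W (δ / 2) ^ p * ∑' j : ℤ, W (δ / 2 * p) * a j ^ p := by
        congr 2
        funext j
        rw [ENNReal.tsum_mul_right]
        congr 1
        exact (Equiv.subLeft j).tsum_eq fun m : ℤ => (2 : ℝ≥0∞) ^ (-(δ / 2 * p) * |(m : ℝ)|)
    _ = _ := by rw [ENNReal.tsum_mul_left, mul_assoc]

lemma two_zpow_eq_rpow (m : ℤ) : (2 : ℝ≥0∞) ^ m = 2 ^ (m : ℝ) := (ENNReal.rpow_intCast 2 m).symm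

lemma rpow_le_tsum_two_rpow {q : ℝ} (hq : 0 < q) (v : ℝ≥0∞) :
    v ^ q ≤ 2 ^ q * ∑' m : ℤ, if (2 : ℝ≥0∞) ^ (m : ℝ) < v then ((2 : ℝ≥0∞) ^ (m : ℝ)) ^ q else 0 := by
  rcases eq_or_ne v 0 with rfl | h0
  · simp [ENNReal.zero_rpow_of_pos hq]
  rcases eq_or_ne v ∞ with rfl | ht
  · have : ∑' m : ℤ, (if (2 : ℝ≥0∞) ^ (m : ℝ) < ∞ then ((2 : ℝ≥0∞) ^ (m : ℝ)) ^ q else 0) = ∞ := by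
      rw [← top_le_iff]
      calc (∞ : ℝ≥0∞) = ∑' m : ℕ, (1 : ℝ≥0∞) :=
            (ENNReal.tsum_const_eq_top_of_ne_zero one_ne_zero).symm
        _ ≤ ∑' m : ℕ, (if (2 : ℝ≥0∞) ^ (((m : ℤ) : ℝ)) < ∞ then
              ((2 : ℝ≥0∞) ^ (((m : ℤ) : ℝ))) ^ q else 0) := by
            refine ENNReal.tsum_le_tsum fun m => ?_
            rw [if_pos (two_rpow_ne_top _).lt_top]
            refine ENNReal.one_le_rpow ?_ hq
            simpa using one_le_pow₀ (M₀ := ℝ≥0∞) one_le_two (n := m)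
        _ ≤ _ := ENNReal.tsum_comp_le_tsum_of_injective Nat.cast_injective
            (fun m : ℤ => if (2 : ℝ≥0∞) ^ (m : ℝ) < ∞ then ((2 : ℝ≥0∞) ^ (m : ℝ)) ^ q else 0)
    rw [this, ENNReal.mul_top (by simp)]
    exact le_top
  · obtain ⟨m, hm1, hm2⟩ := ENNReal.exists_mem_Ioc_zpow h0 ht one_lt_two ofNat_ne_top
    rw [two_zpow_eq_rpow] at hm1 hm2
    have : v ^ q ≤ 2 ^ q * (if (2 : ℝ≥0∞) ^ (m : ℝ) < v then ((2 : ℝ≥0∞) ^ (m : ℝ)) ^ q else 0) := by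
      rw [if_pos hm1, ← ENNReal.mul_rpow_of_nonneg _ _ hq.le]
      refine ENNReal.rpow_le_rpow (hm2.trans (le_of_eq ?_)) hq.le
      push_cast
      rw [two_rpow_add, mul_comm, ENNReal.rpow_one]
    exact this.trans (mul_le_mul_right (ENNReal.le_tsum m) _)

lemma tsum_two_rpow_le {q : ℝ} (hq : 0 < q) (v : ℝ≥0∞) :
    (∑' m : ℤ, if (2 : ℝ≥0∞) ^ (m : ℝ) ≤ v then ((2 : ℝ≥0∞) ^ (m : ℝ)) ^ q else 0) ≤
      (∑' m : ℤ, (2 : ℝ≥0∞) ^ (-q * |(m : ℝ)|)) * v ^ q := by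
  rcases eq_or_ne v 0 with rfl | h0
  · simp [-ENNReal.rpow_intCast]
  rcases eq_or_ne v ∞ with rfl | ht
  · rw [ENNReal.top_rpow_of_pos hq, ENNReal.mul_top]
    · exact le_top
    · exact ((two_rpow_ne_zero _).bot_lt.trans_le (ENNReal.le_tsum (0 : ℤ))).ne'
  obtain ⟨M, hm1, hm2⟩ := ENNReal.exists_mem_Ico_zpow h0 ht one_lt_two ofNat_ne_top
  rw [← (Equiv.subRight M).tsum_eq fun m : ℤ => (2 : ℝ≥0∞) ^ (-q * |(m : ℝ)|),
    ← ENNReal.tsum_mul_right]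
  refine ENNReal.tsum_le_tsum fun m => ?_
  split_ifs with h
  · have hmM : m ≤ M := by
      by_contra! hlt
      rw [two_zpow_eq_rpow] at hm2
      exact (h.trans_lt hm2).not_ge (two_rpow_le_two_rpow (by exact_mod_cast hlt))
    rw [two_zpow_eq_rpow] at hm1
    refine le_trans (le_of_eq ?_) (mul_le_mul_right (ENNReal.rpow_le_rpow hm1 hq.le) _)
    rw [← ENNReal.rpow_mul, ← ENNReal.rpow_mul, ← two_rpow_add]
    have : |((m - M : ℤ) : ℝ)| = M - m := by
      rw [abs_of_nonpos (by exact_mod_cast sub_nonpos.2 hmM)]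
      push_cast
      ring
    simp only [Equiv.subRight_apply, this]
    congr 1
    ring
  · exact zero_le

lemma le_tsum_dyadic {s v : ℝ≥0∞} (hs : s ≠ 0) (hst : s ≠ ∞) (h : s < v) :
    v ≤ ∑' i : ℕ, if s * 2 ^ i < v then s * 2 ^ (i + 1) else 0 := by
  rcases eq_or_ne v ∞ with rfl | ht
  · refine le_of_eq (Eq.symm ?_)
    rw [← top_le_iff]
    calc (∞ : ℝ≥0∞) = ∑' i : ℕ, s := (ENNReal.tsum_const_eq_top_of_ne_zero hs).symm
      _ ≤ _ := by
        refine ENNReal.tsum_le_tsum fun i => ?_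
        rw [if_pos (ENNReal.mul_lt_top hst.lt_top (by simp))]
        exact le_mul_of_one_le_right zero_le (one_le_pow₀ one_le_two)
  have hex : ∃ i : ℕ, v ≤ s * 2 ^ i := by
    obtain ⟨i, hi⟩ := ENNReal.exists_nat_mul_gt hs ht
    refine ⟨i, hi.le.trans ?_⟩
    rw [mul_comm]
    refine mul_le_mul_right ?_ _
    exact_mod_cast i.lt_two_pow_self.le
  classical
  have hfind := Nat.find_spec hex
  rcases hk : Nat.find hex with _ | k
  · rw [hk] at hfind
    simp only [pow_zero, mul_one] at hfind
    exact absurd h hfind.not_gt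
  · have hlt : s * 2 ^ k < v := not_le.1 (Nat.find_min hex (by omega))
    rw [hk] at hfind
    refine le_trans ?_ (ENNReal.le_tsum k)
    rwa [if_pos hlt]

lemma add_rpow_le_two_rpow_mul (a b : ℝ≥0∞) {s : ℝ} (hs : 0 ≤ s) :
    (a + b) ^ s ≤ 2 ^ s * (a ^ s + b ^ s) := by
  rcases le_total a b with h | h
  · calc (a + b) ^ s ≤ (2 * b) ^ s := ENNReal.rpow_le_rpow (by rw [two_mul]; gcongr) hs
      _ = 2 ^ s * b ^ s := ENNReal.mul_rpow_of_nonneg _ _ hs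
      _ ≤ _ := mul_le_mul_right le_add_self _
  · calc (a + b) ^ s ≤ (2 * a) ^ s := ENNReal.rpow_le_rpow (by rw [two_mul]; gcongr) hs
      _ = 2 ^ s * a ^ s := ENNReal.mul_rpow_of_nonneg _ _ hs
      _ ≤ _ := mul_le_mul_right le_self_add _

lemma setLIntegral_rpow_of_ofReal_lt {κ : ℝ} (hκ : 0 < κ) (a : ℝ≥0∞) :
    ∫⁻ t in Ioi (0 : ℝ), (if ENNReal.ofReal t < a then ENNReal.ofReal (t ^ (κ - 1)) else 0)
      = ENNReal.ofReal (1 / κ) * a ^ κ := by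
  have hfin : ∀ b : ℝ≥0, ∫⁻ t in Ioi (0 : ℝ),
      (if ENNReal.ofReal t < b then ENNReal.ofReal (t ^ (κ - 1)) else 0)
      = ENNReal.ofReal (1 / κ) * (b : ℝ≥0∞) ^ κ := by
    intro b
    have hint : IntervalIntegrable (fun t : ℝ => t ^ (κ - 1)) volume 0 b :=
      intervalIntegral.intervalIntegrable_rpow' (by linarith)
    have hint' : IntegrableOn (fun t : ℝ => t ^ (κ - 1)) (Ioo 0 b) :=
      hint.1.mono_set Ioo_subset_Ioc_self
    calc ∫⁻ t in Ioi (0 : ℝ), (if ENNReal.ofReal t < b then ENNReal.ofReal (t ^ (κ - 1)) else 0)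
        = ∫⁻ t in Ioi (0 : ℝ), (Iio (b : ℝ)).indicator (fun t => ENNReal.ofReal (t ^ (κ - 1))) t := by
          refine setLIntegral_congr_fun measurableSet_Ioi fun t ht => ?_
          have : ENNReal.ofReal t < b ↔ t < b := by
            rw [← ENNReal.ofReal_coe_nnreal, ENNReal.ofReal_lt_ofReal_iff']
            exact ⟨fun h => h.1, fun h => ⟨h, lt_trans ht h⟩⟩
          simp only [this, indicator, mem_Iio]
      _ = ∫⁻ t in Ioo (0 : ℝ) b, ENNReal.ofReal (t ^ (κ - 1)) := by
          rw [setLIntegral_indicator measurableSet_Iio, inter_comm, Ioi_inter_Iio]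
      _ = ENNReal.ofReal (∫ t in Ioo (0 : ℝ) b, t ^ (κ - 1)) := by
          rw [ofReal_integral_eq_lintegral_ofReal hint']
          filter_upwards [ae_restrict_mem measurableSet_Ioo] with t ht
          exact Real.rpow_nonneg ht.1.le _
      _ = ENNReal.ofReal ((b : ℝ) ^ κ / κ) := by
          rw [← integral_Ioc_eq_integral_Ioo, ← intervalIntegral.integral_of_le b.coe_nonneg,
            integral_rpow (Or.inl (by linarith))]
          simp [Real.zero_rpow hκ.ne']
      _ = _ := by
          rw [← ENNReal.ofReal_coe_nnreal, ENNReal.ofReal_rpow_of_nonneg b.coe_nonneg hκ.le,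
            ← ENNReal.ofReal_mul (by positivity)]
          congr 1
          ring
  rcases eq_or_ne a ∞ with rfl | ha
  · have htop : Tendsto (fun N : ℕ => ENNReal.ofReal (1 / κ) * ((N : ℝ≥0) : ℝ≥0∞) ^ κ) atTop
        (𝓝 (ENNReal.ofReal (1 / κ) * ∞ ^ κ)) := by
      refine ENNReal.Tendsto.const_mul ?_ (Or.inr (by simp))
      refine (ENNReal.continuous_rpow_const.tendsto _).comp ?_
      simpa using ENNReal.tendsto_nat_nhds_top
    refine le_antisymm ?_ (le_of_tendsto' htop fun N => ?_)
    · rw [ENNReal.top_rpow_of_pos hκ, ENNReal.mul_top (by simpa using hκ)]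
      exact le_top
    · rw [← hfin N]
      refine lintegral_mono fun t => ?_
      dsimp only
      rw [if_pos (ENNReal.ofReal_lt_top)]
      split_ifs
      · exact le_rfl
      · exact zero_le
  · lift a to ℝ≥0 using ha
    exact hfin a

section Lorentz

variable {n : ℕ} {r q : ℝ}

lemma rearrangement_le {f : Euc n → ℝ≥0∞} {s : ℝ≥0∞} {t : ℝ}
    (h : volume {x | s < f x} ≤ ENNReal.ofReal t) : rearrangement f t ≤ s :=
  iInf₂_le s h

lemma lt_volume_of_lt_rearrangement {f : Euc n → ℝ≥0∞} {s : ℝ≥0∞} {t : ℝ}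
    (h : s < rearrangement f t) : ENNReal.ofReal t < volume {x | s < f x} := by
  contrapose! h
  exact rearrangement_le h

lemma le_rearrangement_of_lt_volume {f : Euc n → ℝ≥0∞} {s : ℝ≥0∞} {t : ℝ}
    (h : ENNReal.ofReal t < volume {x | s < f x}) : s ≤ rearrangement f t := by
  refine le_iInf₂ fun s' hs' => ?_
  by_contra! hlt
  exact (h.trans_le ((measure_mono fun x hx => hlt.trans hx).trans hs')).false

/-- The `q`-th power of the Lorentz quasinorm. -/
def lorentzInt (r q : ℝ) (f : Euc n → ℝ≥0∞) : ℝ≥0∞ :=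
  ∫⁻ t in Ioi (0 : ℝ), rearrangement f t ^ q * ENNReal.ofReal (t ^ (q / r - 1))

lemma lorentzNorm_eq (hq : 0 < q) (f : Euc n → ℝ≥0∞) :
    lorentzNorm r q f = lorentzInt r q f ^ (1 / q) := by
  unfold lorentzNorm lorentzInt
  congr 1
  refine setLIntegral_congr_fun measurableSet_Ioi fun t ht => ?_
  have ht : 0 < t := ht
  rw [ENNReal.mul_rpow_of_nonneg _ _ hq.le, mul_comm, mul_div_assoc,
    ENNReal.ofReal_rpow_of_pos (by positivity), ← ENNReal.ofReal_div_of_pos ht,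
    ← Real.rpow_mul ht.le, Real.rpow_sub_one ht.ne']
  congr 4
  ring

/-- A dyadic discretization of the `q`-th power of the Lorentz quasinorm. -/
def lorentzSum (r q : ℝ) (f : Euc n → ℝ≥0∞) : ℝ≥0∞ :=
  ∑' m : ℤ, ((2 : ℝ≥0∞) ^ (m : ℝ)) ^ q * volume {x | (2 : ℝ≥0∞) ^ (m : ℝ) < f x} ^ (q / r)

lemma measurable_ofReal_lt_ite (κ : ℝ) (a : ℝ≥0∞) : Measurable fun t : ℝ =>
    if ENNReal.ofReal t < a then ENNReal.ofReal (t ^ (κ - 1)) else 0 :=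
  Measurable.ite (measurableSet_lt (by fun_prop) measurable_const) (by fun_prop) measurable_const

lemma lorentzSum_eq_lintegral (hr : 0 < r) (hq : 0 < q) (f : Euc n → ℝ≥0∞) :
    ∫⁻ t in Ioi (0 : ℝ), ∑' m : ℤ, ((2 : ℝ≥0∞) ^ (m : ℝ)) ^ q *
      (if ENNReal.ofReal t < volume {x | (2 : ℝ≥0∞) ^ (m : ℝ) < f x} then
        ENNReal.ofReal (t ^ (q / r - 1)) else 0)
      = ENNReal.ofReal (1 / (q / r)) * lorentzSum r q f := by
  rw [lintegral_tsum fun m => ((measurable_ofReal_lt_ite _ _).const_mul _).aemeasurable,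
    lorentzSum, ← ENNReal.tsum_mul_left]
  refine tsum_congr fun m => ?_
  rw [lintegral_const_mul _ (measurable_ofReal_lt_ite _ _),
    setLIntegral_rpow_of_ofReal_lt (by positivity)]
  ring

lemma lorentzInt_le (hr : 0 < r) (hq : 0 < q) (f : Euc n → ℝ≥0∞) :
    lorentzInt r q f ≤ 2 ^ q * (ENNReal.ofReal (1 / (q / r)) * lorentzSum r q f) := by
  rw [← lorentzSum_eq_lintegral hr hq, ← lintegral_const_mul' _ _ (by simp), lorentzInt]
  refine lintegral_mono fun t => ?_
  refine (mul_le_mul_left (rpow_le_tsum_two_rpow hq _) _).trans ?_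
  rw [mul_assoc, ← ENNReal.tsum_mul_right]
  refine mul_le_mul_right (ENNReal.tsum_le_tsum fun m => ?_) _
  split_ifs with h h'
  · exact le_rfl
  · exact absurd (lt_volume_of_lt_rearrangement h) h'
  · simp
  · simp

lemma le_lorentzInt (hr : 0 < r) (hq : 0 < q) (f : Euc n → ℝ≥0∞) :
    ENNReal.ofReal (1 / (q / r)) * lorentzSum r q f ≤
      (∑' m : ℤ, (2 : ℝ≥0∞) ^ (-q * |(m : ℝ)|)) * lorentzInt r q f := by
  rw [← lorentzSum_eq_lintegral hr hq,
    lorentzInt, ← lintegral_const_mul' _ _ (tsum_two_rpow_neg_abs_ne_top hq)]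
  refine lintegral_mono fun t => ?_
  dsimp only
  rw [← mul_assoc]
  refine le_trans ?_ (mul_le_mul_left (tsum_two_rpow_le hq _) _)
  rw [← ENNReal.tsum_mul_right]
  refine ENNReal.tsum_le_tsum fun m => ?_
  split_ifs with h h'
  · exact le_rfl
  · exact absurd (le_rearrangement_of_lt_volume h) h'
  · simp
  · simp

lemma rpow_mul_volume_rpow_le (hr : 0 < r) (hq : 0 < q) (f : Euc n → ℝ≥0∞) (s : ℝ≥0∞) :
    s ^ q * (ENNReal.ofReal (1 / (q / r)) * volume {x | s < f x} ^ (q / r)) ≤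
      lorentzInt r q f := by
  rw [← setLIntegral_rpow_of_ofReal_lt (by positivity),
    ← lintegral_const_mul _ (measurable_ofReal_lt_ite _ _), lorentzInt]
  refine lintegral_mono fun t => ?_
  dsimp only
  split_ifs with h
  · exact mul_le_mul_left (ENNReal.rpow_le_rpow (le_rearrangement_of_lt_volume h) hq.le) _
  · simp

/-- Comparing the dyadic sums compares the Lorentz quasinorms. -/
lemma lorentzNorm_le_of_lorentzSum_le (hr : 0 < r) (hq : 0 < q) {K : ℝ≥0∞} (hK : K ≠ ∞) :
    ∃ C : ℝ≥0∞, C ≠ ∞ ∧ ∀ f g h : Euc n → ℝ≥0∞,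
      lorentzSum r q f ≤ K * (lorentzSum r q g + lorentzSum r q h) →
      lorentzNorm r q f ≤ C * (lorentzNorm r q g + lorentzNorm r q h) := by
  set W := ∑' m : ℤ, (2 : ℝ≥0∞) ^ (-q * |(m : ℝ)|)
  refine ⟨(2 ^ q * (K * W)) ^ (1 / q) * 2 ^ (1 / q), ENNReal.mul_ne_top
    (ENNReal.rpow_ne_top_of_nonneg (by positivity) (ENNReal.mul_ne_top (by simp)
      (ENNReal.mul_ne_top hK (tsum_two_rpow_neg_abs_ne_top hq)))) (by simp),
    fun f g h hfgh => ?_⟩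
  have hI : lorentzInt r q f ≤ 2 ^ q * (K * W) * (lorentzInt r q g + lorentzInt r q h) := by
    set c := ENNReal.ofReal (1 / (q / r))
    calc lorentzInt r q f ≤ 2 ^ q * (c * lorentzSum r q f) := lorentzInt_le hr hq f
      _ ≤ 2 ^ q * (c * (K * (lorentzSum r q g + lorentzSum r q h))) := by gcongr
      _ = 2 ^ q * K * (c * lorentzSum r q g + c * lorentzSum r q h) := by ring
      _ ≤ 2 ^ q * K * (W * lorentzInt r q g + W * lorentzInt r q h) := by
        exact mul_le_mul_right (add_le_add (le_lorentzInt hr hq g) (le_lorentzInt hr hq h)) _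
      _ = _ := by ring
  simp only [lorentzNorm_eq hq]
  calc lorentzInt r q f ^ (1 / q)
      ≤ (2 ^ q * (K * W) * (lorentzInt r q g + lorentzInt r q h)) ^ (1 / q) :=
        ENNReal.rpow_le_rpow hI (by positivity)
    _ = (2 ^ q * (K * W)) ^ (1 / q) * (lorentzInt r q g + lorentzInt r q h) ^ (1 / q) :=
        ENNReal.mul_rpow_of_nonneg _ _ (by positivity)
    _ ≤ (2 ^ q * (K * W)) ^ (1 / q) *
        (2 ^ (1 / q) * (lorentzInt r q g ^ (1 / q) + lorentzInt r q h ^ (1 / q))) := by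
        gcongr
        exact add_rpow_le_two_rpow_mul _ _ (by positivity)
    _ = _ := by rw [mul_assoc]

lemma rearrangement_mono {f g : Euc n → ℝ≥0∞} (h : ∀ x, f x ≤ g x) (t : ℝ) :
    rearrangement f t ≤ rearrangement g t :=
  le_iInf₂ fun s hs => rearrangement_le <| by
    have hsub : {x | s < f x} ⊆ {x | s < g x} := fun x hx => lt_of_lt_of_le hx (h x)
    exact (measure_mono hsub).trans hs

lemma lorentzNorm_mono (hq : 0 < q) {f g : Euc n → ℝ≥0∞} (h : ∀ x, f x ≤ g x) :
    lorentzNorm r q f ≤ lorentzNorm r q g := by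
  rw [lorentzNorm_eq hq, lorentzNorm_eq hq]
  refine ENNReal.rpow_le_rpow (lintegral_mono fun t => ?_) (by positivity)
  exact mul_le_mul_left (ENNReal.rpow_le_rpow (rearrangement_mono h t) hq.le) _

/-- The Lorentz functional satisfies a quasi-triangle inequality. -/
lemma exists_lorentzNorm_add_le (hr : 0 < r) (hq : 0 < q) :
    ∃ C : ℝ≥0∞, C ≠ ∞ ∧ ∀ f g : Euc n → ℝ≥0∞,
      lorentzNorm r q (fun x => f x + g x) ≤ C * (lorentzNorm r q f + lorentzNorm r q g) := by
  have hK : (2 : ℝ≥0∞) ^ q * 2 ^ (q / r) ≠ ∞ :=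
    ENNReal.mul_ne_top (two_rpow_ne_top _) (two_rpow_ne_top _)
  obtain ⟨C, hC, hCle⟩ := lorentzNorm_le_of_lorentzSum_le (n := n) hr hq hK
  refine ⟨C, hC, fun f g => hCle _ _ _ ?_⟩
  unfold lorentzSum
  rw [← ENNReal.tsum_add, ← ENNReal.tsum_mul_left, ← (Equiv.addRight (1 : ℤ)).tsum_eq]
  refine ENNReal.tsum_le_tsum fun m => ?_
  have hm : (2 : ℝ≥0∞) ^ (((Equiv.addRight (1 : ℤ)) m : ℤ) : ℝ) = 2 * 2 ^ (m : ℝ) := by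
    rw [Equiv.coe_addRight]
    push_cast
    rw [two_rpow_add, mul_comm, ENNReal.rpow_one]
  rw [hm]
  set s := (2 : ℝ≥0∞) ^ (m : ℝ)
  have hvol : volume {x | 2 * s < f x + g x} ≤ volume {x | s < f x} + volume {x | s < g x} := by
    refine (measure_mono fun x hx => ?_).trans (measure_union_le _ _)
    by_contra hnot
    simp only [mem_union, mem_ofPred_eq, not_or, not_lt] at hnot hx
    exact (hx.trans_le ((add_le_add hnot.1 hnot.2).trans_eq (two_mul s).symm)).false
  calc (2 * s) ^ q * volume {x | 2 * s < f x + g x} ^ (q / r)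
      ≤ (2 * s) ^ q * (2 ^ (q / r) *
        (volume {x | s < f x} ^ (q / r) + volume {x | s < g x} ^ (q / r))) := by
        gcongr
        exact (ENNReal.rpow_le_rpow hvol (by positivity)).trans
          (add_rpow_le_two_rpow_mul _ _ (by positivity))
    _ = _ := by
        rw [ENNReal.mul_rpow_of_nonneg _ _ hq.le]
        ring

lemma lorentzNorm_indicator_const_le (hr : 0 < r) (hq : 0 < q) (A : Set (Euc n)) (c : ℝ≥0∞) :
    lorentzNorm r q (A.indicator fun _ => c) ≤
      ENNReal.ofReal (1 / (q / r)) ^ (1 / q) * (c * volume A ^ (1 / r)) := by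
  have hle : lorentzInt r q (A.indicator fun _ => c) ≤
      c ^ q * (ENNReal.ofReal (1 / (q / r)) * volume A ^ (q / r)) := by
    rw [← setLIntegral_rpow_of_ofReal_lt (by positivity),
      ← lintegral_const_mul _ (measurable_ofReal_lt_ite _ _), lorentzInt]
    refine lintegral_mono fun t => ?_
    dsimp only
    split_ifs with h
    · refine mul_le_mul_left (ENNReal.rpow_le_rpow (rearrangement_le ?_) hq.le) _
      have : {x | c < A.indicator (fun _ => c) x} = ∅ := by
        ext x
        by_cases hx : x ∈ A <;> simp [hx]
      simp [this]
    · have : rearrangement (A.indicator fun _ => c) t = 0 := by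
        have hsub : {x | 0 < A.indicator (fun _ => c) x} ⊆ A := fun x hx => by
          by_contra hxA
          simp [hxA] at hx
        exact le_antisymm (rearrangement_le ((measure_mono hsub).trans (not_lt.1 h))) zero_le
      rw [this, ENNReal.zero_rpow_of_pos hq, zero_mul]
      exact zero_le
  rw [lorentzNorm_eq hq]
  refine (ENNReal.rpow_le_rpow hle (by positivity)).trans (le_of_eq ?_)
  rw [ENNReal.mul_rpow_of_nonneg _ _ (by positivity), ENNReal.mul_rpow_of_nonneg _ _ (by positivity),
    ← ENNReal.rpow_mul, ← ENNReal.rpow_mul, mul_one_div_cancel hq.ne', ENNReal.rpow_one,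
    show q / r * (1 / q) = 1 / r by field_simp]
  ring

end Lorentz

section Maximal

variable {n : ℕ} {r q : ℝ}

lemma volume_ball_eq {n : ℕ} (c : Euc n) {ρ : ℝ} (hρ : 0 < ρ) :
    volume (Metric.ball c ρ) = ENNReal.ofReal (ρ ^ n) * volume (Metric.ball (0 : Euc n) 1) := by
  rw [Measure.addHaar_ball_of_pos _ _ hρ, finrank_euclideanSpace_fin]

lemma volume_unit_ball_ne_zero (n : ℕ) : volume (Metric.ball (0 : Euc n) 1) ≠ 0 :=
  (Metric.measure_ball_pos _ _ one_pos).ne'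

lemma volume_ball_two_rpow {n : ℕ} (c : Euc n) (x : ℝ) :
    volume (Metric.ball c ((2 : ℝ) ^ x)) =
      (2 : ℝ≥0∞) ^ (x * n) * volume (Metric.ball (0 : Euc n) 1) := by
  rw [volume_ball_eq _ (by positivity), two_rpow_eq_ofReal, Real.rpow_mul two_pos.le,
    Real.rpow_natCast]

/-- The weak type `(1, 1)` estimate for the maximal operator. -/
lemma mul_volume_lt_maximalFn_le (hn : 0 < n) (f : Euc n → ℝ≥0∞) {s : ℝ≥0∞} (hs : s ≠ 0)
    (hst : s ≠ ∞) : s * volume {x | s < maximalFn f x} ≤ 5 ^ n * ∫⁻ x, f x := by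
  set I := ∫⁻ x, f x
  set v := volume (Metric.ball (0 : Euc n) 1)
  have hv0 : v ≠ 0 := volume_unit_ball_ne_zero n
  have hvt : v ≠ ∞ := measure_ball_lt_top.ne
  rcases eq_or_ne I ∞ with hIt | hIt
  · rw [hIt, ENNReal.mul_top (by simp)]
    exact le_top
  set t : Set (Euc n × ℝ) := {b | 0 < b.2 ∧
    s * volume (Metric.ball b.1 b.2) ≤ ∫⁻ y in Metric.ball b.1 b.2, f y}
  have hbdd : ∀ b ∈ t, b.2 ≤ max 1 (I / (s * v)).toReal := by
    rintro ⟨c, ρ⟩ ⟨hρ, hb⟩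
    rcases le_total ρ 1 with h1 | h1
    · exact le_max_of_le_left h1
    refine le_max_of_le_right ?_
    rw [← ENNReal.ofReal_le_iff_le_toReal (ENNReal.div_ne_top hIt (mul_ne_zero hs hv0)),
      ENNReal.le_div_iff_mul_le (Or.inl (mul_ne_zero hs hv0)) (Or.inl (ENNReal.mul_ne_top hst hvt))]
    calc ENNReal.ofReal ρ * (s * v) ≤ ENNReal.ofReal (ρ ^ n) * (s * v) := by
          gcongr
          exact le_self_pow₀ h1 hn.ne'
      _ = s * volume (Metric.ball c ρ) := by
          rw [volume_ball_eq c hρ]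
          ring
      _ ≤ _ := hb
      _ ≤ I := setLIntegral_le_lintegral _ _
  obtain ⟨u, hut, hdisj, hcov⟩ := Vitali.exists_disjoint_subfamily_covering_enlargement_closedBall
    t (fun b => b.1) (fun b => b.2) _ hbdd 5 (by norm_num)
  have hdisj' : u.PairwiseDisjoint fun b => Metric.ball b.1 b.2 := fun a ha b hb hab =>
    (hdisj ha hb hab).mono Metric.ball_subset_closedBall Metric.ball_subset_closedBall
  have hcount : u.Countable := hdisj'.countable_of_isOpen (fun _ _ => Metric.isOpen_ball)
    fun b hb => Metric.nonempty_ball.2 (hut hb).1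
  have hsub : {x | s < maximalFn f x} ⊆ ⋃ b ∈ u, Metric.closedBall b.1 (5 * b.2) := by
    intro x hx
    have hx : s < maximalFn f x := hx
    simp only [maximalFn, lt_iSup_iff] at hx
    obtain ⟨c, ρ, hρ, hxb, hlt⟩ := hx
    have hmem : (c, ρ) ∈ t := by
      refine ⟨hρ, ?_⟩
      dsimp only
      rw [mul_comm, ← div_eq_mul_inv] at hlt
      refine le_of_lt ?_
      rwa [ENNReal.lt_div_iff_mul_lt (Or.inl (Metric.measure_ball_pos _ _ hρ).ne')
        (Or.inl measure_ball_lt_top.ne)] at hlt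
    obtain ⟨b, hbu, hb⟩ := hcov _ hmem
    exact mem_biUnion hbu (hb (Metric.ball_subset_closedBall hxb))
  calc s * volume {x | s < maximalFn f x}
      ≤ s * ∑' b : u, volume (Metric.closedBall b.1.1 (5 * b.1.2)) := by
        gcongr
        exact (measure_mono hsub).trans (measure_biUnion_le _ hcount _)
    _ = 5 ^ n * ∑' b : u, s * volume (Metric.ball b.1.1 b.1.2) := by
        rw [← ENNReal.tsum_mul_left, ← ENNReal.tsum_mul_left]
        refine tsum_congr fun b => ?_
        have hb := (hut b.2).1
        rw [Measure.addHaar_closedBall _ _ (by positivity), finrank_euclideanSpace_fin,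
          volume_ball_eq _ hb, mul_pow, ENNReal.ofReal_mul (by positivity),
          ENNReal.ofReal_pow (by norm_num)]
        simp only [ENNReal.ofReal_ofNat]
        ring
    _ ≤ 5 ^ n * ∑' b : u, ∫⁻ y in Metric.ball b.1.1 b.1.2, f y := by
        gcongr with b
        exact (hut b.2).2
    _ = 5 ^ n * ∫⁻ y in ⋃ b ∈ u, Metric.ball b.1 b.2, f y := by
        rw [lintegral_biUnion hcount (fun _ _ => measurableSet_ball) hdisj']
    _ ≤ 5 ^ n * I := by
        gcongr
        exact setLIntegral_le_lintegral _ _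

lemma setLIntegral_lt_le_tsum {f : Euc n → ℝ≥0∞} (hf : Measurable f) {s : ℝ≥0∞} (hs : s ≠ 0)
    (hst : s ≠ ∞) : ∫⁻ x in {x | s < f x}, f x ≤
      ∑' i : ℕ, s * 2 ^ (i + 1) * volume {x | s * 2 ^ i < f x} := by
  have hmeas : ∀ i : ℕ, MeasurableSet {x | s * 2 ^ i < f x} := fun i =>
    measurableSet_lt measurable_const hf
  calc ∫⁻ x in {x | s < f x}, f x
      ≤ ∫⁻ x in {x | s < f x}, ∑' i : ℕ,
          ({x | s * 2 ^ i < f x}.indicator fun _ => s * 2 ^ (i + 1)) x := by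
        refine setLIntegral_mono' (measurableSet_lt measurable_const hf) fun x hx => ?_
        exact (le_tsum_dyadic hs hst hx).trans_eq (tsum_congr fun i => by simp [indicator])
    _ ≤ ∫⁻ x, ∑' i : ℕ, ({x | s * 2 ^ i < f x}.indicator fun _ => s * 2 ^ (i + 1)) x :=
        setLIntegral_le_lintegral _ _
    _ = _ := by
        rw [lintegral_tsum fun i => (measurable_const.indicator (hmeas i)).aemeasurable]
        refine tsum_congr fun i => ?_
        rw [lintegral_indicator_const (hmeas i)]

lemma maximalFn_le_maximalFn_indicator_add {f : Euc n → ℝ≥0∞}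
    (s : ℝ≥0∞) (x : Euc n) :
    maximalFn f x ≤ maximalFn ({x | s < f x}.indicator f) x + s := by
  refine iSup_le fun c => iSup_le fun ρ => iSup_le fun hρ => iSup_le fun hx => ?_
  have h0 : volume (Metric.ball c ρ) ≠ 0 := (Metric.measure_ball_pos _ _ hρ).ne'
  have ht : volume (Metric.ball c ρ) ≠ ∞ := measure_ball_lt_top.ne
  calc (volume (Metric.ball c ρ))⁻¹ * ∫⁻ y in Metric.ball c ρ, f y
      ≤ (volume (Metric.ball c ρ))⁻¹ *
          ∫⁻ y in Metric.ball c ρ, ({x | s < f x}.indicator f y + s) := by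
        gcongr with y
        by_cases hy : s < f y
        · simp [indicator, hy]
        · simpa [indicator, hy] using not_lt.1 hy
    _ = (volume (Metric.ball c ρ))⁻¹ * (∫⁻ y in Metric.ball c ρ, {x | s < f x}.indicator f y) +
          s := by
        rw [lintegral_add_right _ measurable_const, mul_add, setLIntegral_const,
          mul_comm s, ← mul_assoc, ENNReal.inv_mul_cancel h0 ht, one_mul]
    _ ≤ _ := by
        refine add_le_add_left ?_ s
        exact le_iSup₂_of_le c ρ (le_iSup₂_of_le hρ hx le_rfl)

lemma volume_lt_maximalFn_le_tsum (hn : 0 < n) {f : Euc n → ℝ≥0∞} (hf : Measurable f) {s : ℝ≥0∞}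
    (hs : s ≠ 0) (hst : s ≠ ∞) : volume {x | 2 * s < maximalFn f x} ≤
      2 * 5 ^ n * ∑' i : ℕ, 2 ^ i * volume {x | s * 2 ^ i < f x} := by
  have hsub : {x | 2 * s < maximalFn f x} ⊆ {x | s < maximalFn ({x | s < f x}.indicator f) x} := by
    intro x hx
    have hx : 2 * s < maximalFn f x := hx
    by_contra hnot
    have hnot : maximalFn ({x | s < f x}.indicator f) x ≤ s := not_lt.1 hnot
    refine (hx.trans_le ((maximalFn_le_maximalFn_indicator_add s x).trans
      (add_le_add_left hnot s))).ne ?_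
    rw [two_mul]
  refine (measure_mono hsub).trans ?_
  have h := (mul_volume_lt_maximalFn_le hn ({x | s < f x}.indicator f) hs hst)
  rw [lintegral_indicator (measurableSet_lt measurable_const hf)] at h
  have h2 := h.trans (mul_le_mul_right (setLIntegral_lt_le_tsum hf hs hst) (5 ^ n))
  rw [← ENNReal.mul_le_mul_iff_right hs hst]
  refine h2.trans (le_of_eq ?_)
  simp_rw [← ENNReal.tsum_mul_left]
  refine tsum_congr fun i => ?_
  ring

lemma exists_lorentzSum_maximalFn_le (hn : 0 < n) (hr : 1 < r) (hq : 0 < q) :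
    ∃ K : ℝ≥0∞, K ≠ ∞ ∧ ∀ f : Euc n → ℝ≥0∞, Measurable f →
      lorentzSum r q (maximalFn f) ≤ K * lorentzSum r q f := by
  have hr0 : 0 < r := by linarith
  obtain ⟨C, hC, hconv⟩ := exists_tsum_conv_rpow_le (sub_pos.2 hr) (div_pos hq hr0)
  have hB : (2 * 5 ^ n : ℝ≥0∞) ^ (q / r) ≠ ∞ :=
    ENNReal.rpow_ne_top_of_nonneg (by positivity)
      (ENNReal.mul_ne_top ofNat_ne_top (ENNReal.pow_ne_top ofNat_ne_top))
  refine ⟨2 ^ q * (2 * 5 ^ n) ^ (q / r) * C,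
    ENNReal.mul_ne_top (ENNReal.mul_ne_top (by simp) hB) hC, fun f hf => ?_⟩
  set b : ℤ → ℝ≥0∞ := fun j =>
    ((2 : ℝ≥0∞) ^ (j : ℝ)) ^ r * volume {x | (2 : ℝ≥0∞) ^ (j : ℝ) < f x} with hb
  have hbsum : ∑' j : ℤ, b j ^ (q / r) = lorentzSum r q f := by
    refine tsum_congr fun j => ?_
    rw [hb, ENNReal.mul_rpow_of_nonneg _ _ (by positivity), ← ENNReal.rpow_mul _ r,
      mul_div_cancel₀ _ hr0.ne']
  rw [mul_assoc, ← hbsum]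
  refine le_trans ?_ (mul_le_mul_right (hconv b) _)
  rw [lorentzSum, ← ENNReal.tsum_mul_left, ← (Equiv.addRight (1 : ℤ)).tsum_eq]
  refine ENNReal.tsum_le_tsum fun m => ?_
  have hm : (2 : ℝ≥0∞) ^ (((Equiv.addRight (1 : ℤ)) m : ℤ) : ℝ) = 2 * 2 ^ (m : ℝ) := by
    rw [Equiv.coe_addRight]
    push_cast
    rw [two_rpow_add, mul_comm, ENNReal.rpow_one]
  rw [hm]
  have hsum : ((2 : ℝ≥0∞) ^ (m : ℝ)) ^ r *
      ∑' i : ℕ, 2 ^ i * volume {x | (2 : ℝ≥0∞) ^ (m : ℝ) * 2 ^ i < f x} ≤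
      ∑' j : ℤ, (2 : ℝ≥0∞) ^ (-(r - 1) * |((j - m : ℤ) : ℝ)|) * b j := by
    have hinj : Function.Injective fun i : ℕ => m + (i : ℤ) := fun i j hij => by
      simpa using hij
    rw [← ENNReal.tsum_mul_left]
    refine le_trans (le_of_eq (tsum_congr fun i => ?_)) (ENNReal.tsum_comp_le_tsum_of_injective hinj
      fun j : ℤ => (2 : ℝ≥0∞) ^ (-(r - 1) * |((j - m : ℤ) : ℝ)|) * b j)
    have h1 : (2 : ℝ≥0∞) ^ ((m + (i : ℤ) : ℤ) : ℝ) = 2 ^ (m : ℝ) * 2 ^ i := by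
      push_cast
      rw [two_rpow_add, ENNReal.rpow_natCast]
    simp only [hb]
    rw [h1, ← mul_assoc, ← mul_assoc]
    congr 1
    rw [← ENNReal.rpow_natCast, ← two_rpow_add, ← ENNReal.rpow_mul, ← ENNReal.rpow_mul,
      ← two_rpow_add, ← two_rpow_add]
    congr 1
    simp only [add_sub_cancel_left, Int.cast_natCast, Nat.abs_cast]
    ring
  calc (2 * (2 : ℝ≥0∞) ^ (m : ℝ)) ^ q *
        volume {x | 2 * (2 : ℝ≥0∞) ^ (m : ℝ) < maximalFn f x} ^ (q / r)
      ≤ (2 * (2 : ℝ≥0∞) ^ (m : ℝ)) ^ q * (2 * 5 ^ n *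
        ∑' i : ℕ, 2 ^ i * volume {x | (2 : ℝ≥0∞) ^ (m : ℝ) * 2 ^ i < f x}) ^ (q / r) := by
        gcongr
        exact volume_lt_maximalFn_le_tsum hn hf (two_rpow_ne_zero _) (two_rpow_ne_top _)
    _ = 2 ^ q * (2 * 5 ^ n) ^ (q / r) * (((2 : ℝ≥0∞) ^ (m : ℝ)) ^ r *
        ∑' i : ℕ, 2 ^ i * volume {x | (2 : ℝ≥0∞) ^ (m : ℝ) * 2 ^ i < f x}) ^ (q / r) := by
        rw [ENNReal.mul_rpow_of_nonneg _ _ hq.le,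
          ENNReal.mul_rpow_of_nonneg (2 * 5 ^ n) _ (by positivity),
          ENNReal.mul_rpow_of_nonneg (_ ^ r) _ (by positivity),
          ← ENNReal.rpow_mul _ r, mul_div_cancel₀ _ hr0.ne']
        ring
    _ ≤ _ := by gcongr

/-- The maximal operator is bounded on the Lorentz space `L^{r,q}` for `1 < r`. -/
lemma exists_lorentzNorm_maximalFn_le (hn : 0 < n) (hr : 1 < r) (hq : 0 < q) :
    ∃ C : ℝ≥0∞, C ≠ ∞ ∧ ∀ f : Euc n → ℝ≥0∞, Measurable f →
      lorentzNorm r q (maximalFn f) ≤ C * lorentzNorm r q f := by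
  obtain ⟨K, hK, hKle⟩ := exists_lorentzSum_maximalFn_le hn hr hq
  obtain ⟨C, hC, hCle⟩ := lorentzNorm_le_of_lorentzSum_le (n := n) (by linarith : 0 < r) hq hK
  refine ⟨C * 2, ENNReal.mul_ne_top hC ofNat_ne_top, fun f hf => ?_⟩
  have h := hCle (maximalFn f) f f ((hKle f hf).trans (mul_le_mul_right le_self_add _))
  rwa [← two_mul, ← mul_assoc] at h

lemma tsum_two_rpow_mul_natCast_ne_top {δ : ℝ} (hδ : 0 < δ) :
    ∑' i : ℕ, (2 : ℝ≥0∞) ^ (-δ * (i : ℝ)) ≠ ∞ := by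
  refine ne_top_of_le_ne_top (tsum_two_rpow_neg_abs_ne_top hδ) (le_trans (le_of_eq ?_)
    (ENNReal.tsum_comp_le_tsum_of_injective Nat.cast_injective _))
  simp

/-- Hölder's inequality for `L^{r,q}` functions on a set of finite measure. -/
lemma exists_lintegral_le_lorentzNorm (hr : 1 < r) (hq : 0 < q) :
    ∃ C : ℝ≥0∞, C ≠ ∞ ∧ ∀ (f : Euc n → ℝ≥0∞) (A : Set (Euc n)), Measurable f →
      volume A ≠ 0 → volume A ≠ ∞ →
      ∫⁻ x in A, f x ≤ C * (volume A ^ (1 - 1 / r) * lorentzNorm r q f) := by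
  have hr0 : 0 < r := by linarith
  set G := ∑' i : ℕ, (2 : ℝ≥0∞) ^ (-(r - 1) * (i : ℝ))
  have hGt : G ≠ ∞ := tsum_two_rpow_mul_natCast_ne_top (sub_pos.2 hr)
  set c := ENNReal.ofReal (1 / (q / r)) ^ (1 / q) with hc
  have hc0 : c ≠ 0 := by
    rw [hc]
    simp [ENNReal.rpow_eq_zero_iff, hq, hr0, hq.not_gt]
  have hct : c ≠ ∞ := ENNReal.rpow_ne_top_of_nonneg (by positivity) ofReal_ne_top
  refine ⟨c⁻¹ * (1 + 2 * G), by finiteness, fun f A hf hA0 hAt => ?_⟩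
  set a := c⁻¹ * lorentzNorm r q f with ha
  have hweak : ∀ s : ℝ≥0∞, s * volume {x | s < f x} ^ (1 / r) ≤ a := by
    intro s
    rw [ha, mul_comm c⁻¹, ← div_eq_mul_inv, ENNReal.le_div_iff_mul_le (Or.inl hc0) (Or.inl hct),
      lorentzNorm_eq hq]
    refine le_trans (le_of_eq ?_)
      (ENNReal.rpow_le_rpow (rpow_mul_volume_rpow_le hr0 hq f s) (by positivity))
    rw [ENNReal.mul_rpow_of_nonneg _ _ (by positivity),
      ENNReal.mul_rpow_of_nonneg _ _ (by positivity), ← ENNReal.rpow_mul, ← ENNReal.rpow_mul,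
      mul_one_div_cancel hq.ne', ENNReal.rpow_one, show q / r * (1 / q) = 1 / r by field_simp]
    ring
  suffices h : ∫⁻ x in A, f x ≤ a * volume A ^ (1 - 1 / r) * (1 + 2 * G) by
    refine h.trans (le_of_eq ?_)
    rw [ha]
    ring
  rcases eq_or_ne a 0 with ha0 | ha0
  · have hae : f =ᵐ[volume] 0 := by
      have : ∀ i : ℕ, ∀ᵐ x, f x ≤ ((i : ℝ≥0∞))⁻¹ := by
        intro i
        have h := hweak (i : ℝ≥0∞)⁻¹
        rw [ha0, nonpos_iff_eq_zero, mul_eq_zero, ENNReal.rpow_eq_zero_iff] at h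
        have h1 : volume {x | (i : ℝ≥0∞)⁻¹ < f x} = 0 := by
          rcases h with h | h | h
          · simp at h
          · exact h.1
          · exact absurd h.2 (by positivity : (0 : ℝ) < 1 / r).not_gt
        rw [ae_iff]
        simpa only [not_le] using h1
      filter_upwards [ae_all_iff.2 this] with x hx
      by_contra hne
      obtain ⟨i, hi⟩ := ENNReal.exists_inv_nat_lt hne
      exact hi.not_ge (hx i)
    rw [lintegral_congr_ae (ae_restrict_of_ae hae)]
    simp
  rcases eq_or_ne a ∞ with hat | hat
  · rw [hat, ENNReal.top_mul (by simp [ENNReal.rpow_eq_zero_iff, hA0, hAt]),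
      ENNReal.top_mul (by simp)]
    exact le_top
  set V := volume A
  set s := a * V ^ (-(1 / r)) with hs
  have hVr0 : V ^ (-(1 / r)) ≠ 0 := by simp [ENNReal.rpow_eq_zero_iff, hA0, hAt]
  have hVrt : V ^ (-(1 / r)) ≠ ∞ := by simp [ENNReal.rpow_eq_top_iff, hA0, hAt]
  have hs0 : s ≠ 0 := mul_ne_zero ha0 hVr0
  have hst : s ≠ ∞ := ENNReal.mul_ne_top hat hVrt
  have hsV : s * V = a * V ^ (1 - 1 / r) := by
    rw [hs, mul_assoc, sub_eq_neg_add, ENNReal.rpow_add _ _ hA0 hAt, ENNReal.rpow_one]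
  have hasr : (a / s) ^ r = V := by
    have : a / s = V ^ (1 / r) := by
      rw [hs, ENNReal.rpow_neg, ENNReal.div_eq_inv_mul, ENNReal.mul_inv (Or.inl ha0) (Or.inl hat),
        inv_inv, mul_right_comm, ENNReal.inv_mul_cancel ha0 hat, one_mul]
    rw [this, ← ENNReal.rpow_mul, one_div_mul_cancel hr0.ne', ENNReal.rpow_one]
  have hterm : ∀ i : ℕ, s * 2 ^ (i + 1) * volume {x | s * 2 ^ i < f x} ≤
      2 * (s * V) * (2 : ℝ≥0∞) ^ (-(r - 1) * (i : ℝ)) := by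
    intro i
    have h20 : (2 : ℝ≥0∞) ^ i ≠ 0 := by simp
    have h2t : (2 : ℝ≥0∞) ^ i ≠ ∞ := by simp
    have h1 : volume {x | s * 2 ^ i < f x} ≤ V * (2 : ℝ≥0∞) ^ (-(r * i)) := by
      have h2 : volume {x | s * 2 ^ i < f x} ^ (1 / r) ≤ a / (s * 2 ^ i) := by
        rw [ENNReal.le_div_iff_mul_le (Or.inl (mul_ne_zero hs0 h20))
          (Or.inl (ENNReal.mul_ne_top hst h2t)), mul_comm]
        exact hweak _
      have h3 := ENNReal.rpow_le_rpow h2 hr0.le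
      rw [← ENNReal.rpow_mul, one_div_mul_cancel hr0.ne', ENNReal.rpow_one] at h3
      refine h3.trans (le_of_eq ?_)
      rw [div_eq_mul_inv, ENNReal.mul_inv (Or.inl hs0) (Or.inl hst), ← mul_assoc,
        ← div_eq_mul_inv a s, ENNReal.mul_rpow_of_nonneg _ _ hr0.le, hasr, ENNReal.inv_rpow,
        ← ENNReal.rpow_natCast, ← ENNReal.rpow_mul, ENNReal.rpow_neg, mul_comm r]
    calc s * 2 ^ (i + 1) * volume {x | s * 2 ^ i < f x}
        ≤ s * 2 ^ (i + 1) * (V * (2 : ℝ≥0∞) ^ (-(r * i))) := by gcongr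
      _ = 2 * (s * V) * (2 ^ i * (2 : ℝ≥0∞) ^ (-(r * i))) := by ring
      _ = _ := by
        rw [← ENNReal.rpow_natCast, ← two_rpow_add]
        congr 2
        ring
  calc ∫⁻ x in A, f x ≤ ∫⁻ x in A, (s + {x | s < f x}.indicator f x) := by
        refine lintegral_mono fun x => ?_
        by_cases hx : s < f x
        · simp [indicator, hx]
        · simpa [indicator, hx] using not_lt.1 hx
    _ ≤ s * V + ∫⁻ x in {x | s < f x}, f x := by
        rw [lintegral_add_left measurable_const, setLIntegral_const,
          ← lintegral_indicator (measurableSet_lt measurable_const hf)]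
        exact add_le_add_right (setLIntegral_le_lintegral _ _) _
    _ ≤ s * V + ∑' i : ℕ, 2 * (s * V) * (2 : ℝ≥0∞) ^ (-(r - 1) * (i : ℝ)) := by
        gcongr
        exact (setLIntegral_lt_le_tsum hf hs0 hst).trans (ENNReal.tsum_le_tsum hterm)
    _ = s * V * (1 + 2 * G) := by
        rw [ENNReal.tsum_mul_left]
        ring
    _ = _ := by rw [hsV]

end Maximal

section Herz

variable {n : ℕ} {r q : ℝ}

lemma mem_annulus {k : ℤ} {x : Euc n} :
    x ∈ annulus n k ↔ ‖x‖ < (2 : ℝ) ^ k ∧ (2 : ℝ) ^ (k - 1) ≤ ‖x‖ := by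
  simp [annulus]

lemma measurableSet_annulus (n : ℕ) (k : ℤ) : MeasurableSet (annulus n k) :=
  measurableSet_ball.diff measurableSet_ball

lemma exists_mem_annulus {x : Euc n} (hx : x ≠ 0) : ∃ k : ℤ, x ∈ annulus n k := by
  obtain ⟨m, h1, h2⟩ := exists_mem_Ico_zpow (norm_pos_iff.2 hx) one_lt_two
  exact ⟨m + 1, mem_annulus.2 ⟨h2, by simpa using h1⟩⟩

lemma volume_ball_two_zpow (c : Euc n) (k : ℤ) :
    volume (Metric.ball c ((2 : ℝ) ^ k)) =
      (2 : ℝ≥0∞) ^ ((k : ℝ) * n) * volume (Metric.ball (0 : Euc n) 1) := by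
  rw [← Real.rpow_intCast, volume_ball_two_rpow]

lemma two_zpow_le_radius {j k : ℤ} (hjk : j + 2 ≤ k) {x y c : Euc n} {ρ : ℝ}
    (hx : x ∈ annulus n k) (hy : y ∈ annulus n j) (hxB : x ∈ Metric.ball c ρ)
    (hyB : y ∈ Metric.ball c ρ) : (2 : ℝ) ^ (k - 3) ≤ ρ := by
  have hx' := (mem_annulus.1 hx).2
  have hy' := (mem_annulus.1 hy).1
  have h1 : (2 : ℝ) ^ j ≤ 2 ^ (k - 2) := zpow_le_zpow_right₀ one_le_two (by omega)
  have h2 : (2 : ℝ) ^ (k - 2) = 2 * 2 ^ (k - 3) := by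
    rw [← zpow_one_add₀ two_ne_zero]
    congr 1
    ring
  have h3 : (2 : ℝ) ^ (k - 1) = 4 * 2 ^ (k - 3) := by
    rw [show (4 : ℝ) = 2 ^ (2 : ℤ) by norm_num, ← zpow_add₀ two_ne_zero]
    congr 1
    ring
  have h4 : dist x y < ρ + ρ :=
    (dist_triangle_right x y c).trans_lt (add_lt_add hxB hyB)
  have h5 : ‖x‖ ≤ dist x y + ‖y‖ := by
    rw [dist_eq_norm]
    exact norm_le_norm_sub_add x y
  linarith

/-- Averages over a ball meeting two non-adjacent annuli. -/
lemma inv_volume_ball_mul_setLIntegral_annulus_le {j k : ℤ} (hjk : j + 2 ≤ k ∨ k + 2 ≤ j)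
    (f : Euc n → ℝ≥0∞) {x c : Euc n} {ρ : ℝ} (hx : x ∈ annulus n k)
    (hxB : x ∈ Metric.ball c ρ) :
    (volume (Metric.ball c ρ))⁻¹ * ∫⁻ y in Metric.ball c ρ, (annulus n j).indicator f y ≤
      (2 ^ ((-3 : ℝ) * n) * volume (Metric.ball (0 : Euc n) 1))⁻¹ *
        (2 ^ (-(max (j : ℝ) k * n)) * ∫⁻ y in annulus n j, f y) := by
  rw [setLIntegral_indicator (measurableSet_annulus n j)]
  by_cases hne : (annulus n j ∩ Metric.ball c ρ).Nonempty
  · obtain ⟨y, hy, hyB⟩ := hne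
    have hrad : (2 : ℝ) ^ (max j k - 3) ≤ ρ := by
      rcases hjk with h | h
      · rw [max_eq_right (by omega)]
        exact two_zpow_le_radius h hx hy hxB hyB
      · rw [max_eq_left (by omega)]
        exact two_zpow_le_radius h hy hx hyB hxB
    have hvol : (2 : ℝ≥0∞) ^ (max (j : ℝ) k * n) *
        (2 ^ ((-3 : ℝ) * n) * volume (Metric.ball (0 : Euc n) 1)) ≤ volume (Metric.ball c ρ) := by
      refine le_trans (le_of_eq ?_) (measure_mono (Metric.ball_subset_ball hrad))
      rw [volume_ball_two_zpow, ← mul_assoc, ← two_rpow_add]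
      congr 2
      push_cast
      ring
    calc (volume (Metric.ball c ρ))⁻¹ * ∫⁻ y in annulus n j ∩ Metric.ball c ρ, f y
        ≤ ((2 : ℝ≥0∞) ^ (max (j : ℝ) k * n) *
          (2 ^ ((-3 : ℝ) * n) * volume (Metric.ball (0 : Euc n) 1)))⁻¹ *
            ∫⁻ y in annulus n j, f y := by
          gcongr
          exact inter_subset_left
      _ = _ := by
          rw [ENNReal.mul_inv (Or.inl (two_rpow_ne_zero _)) (Or.inl (two_rpow_ne_top _)),
            ENNReal.rpow_neg]
          ring
  · rw [not_nonempty_iff_eq_empty.1 hne]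
    simp

/-- The constant bounding, on the annulus `C_k`, the contribution to the maximal function of the
pieces of `f` on the other annuli. -/
def farSum (f : Euc n → ℝ≥0∞) (k : ℤ) : ℝ≥0∞ :=
  ∑' j : ℤ, 2 ^ (-(max (j : ℝ) k * n)) * ∫⁻ y in annulus n j, f y

/-- The restriction of `f` to the annulus `C_k` and the two adjacent ones. -/
def nearPart (f : Euc n → ℝ≥0∞) (k : ℤ) (x : Euc n) : ℝ≥0∞ :=
  (annulus n (k - 1)).indicator f x +
    ((annulus n k).indicator f x + (annulus n (k + 1)).indicator f x)

lemma ae_ne_zero_euc (hn : 0 < n) : ∀ᵐ y : Euc n, y ≠ 0 := by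
  have : Nonempty (Fin n) := ⟨⟨0, hn⟩⟩
  have : Nontrivial (Euc n) := inferInstance
  exact Measure.ae_ne volume 0

lemma measurable_nearPart {f : Euc n → ℝ≥0∞} (hf : Measurable f) (k : ℤ) :
    Measurable (nearPart f k) :=
  (hf.indicator (measurableSet_annulus _ _)).add
    ((hf.indicator (measurableSet_annulus _ _)).add (hf.indicator (measurableSet_annulus _ _)))

lemma maximalFn_le_nearPart_add_farSum (hn : 0 < n) {f : Euc n → ℝ≥0∞} (hf : Measurable f)
    {k : ℤ} {x : Euc n} (hx : x ∈ annulus n k) :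
    maximalFn f x ≤ maximalFn (nearPart f k) x +
      (2 ^ ((-3 : ℝ) * n) * volume (Metric.ball (0 : Euc n) 1))⁻¹ * farSum f k := by
  refine iSup_le fun c => iSup_le fun ρ => iSup_le fun hρ => iSup_le fun hxB => ?_
  set far : ℤ → Euc n → ℝ≥0∞ := fun j y =>
    if j + 2 ≤ k ∨ k + 2 ≤ j then (annulus n j).indicator f y else 0 with hfar
  have hfarm : ∀ j, Measurable (far j) := fun j => by
    by_cases h : j + 2 ≤ k ∨ k + 2 ≤ j
    · simpa only [hfar, if_pos h] using hf.indicator (measurableSet_annulus _ _)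
    · simpa only [hfar, if_neg h] using measurable_const
  have hpt : ∀ᵐ y : Euc n, f y ≤ nearPart f k y + ∑' j, far j y := by
    filter_upwards [ae_ne_zero_euc hn] with y hy
    obtain ⟨j, hj⟩ := exists_mem_annulus hy
    by_cases h : j + 2 ≤ k ∨ k + 2 ≤ j
    · refine le_add_left (le_trans (le_of_eq ?_) (ENNReal.le_tsum j))
      simp only [hfar, if_pos h, indicator_of_mem hj]
    · refine le_add_right ?_
      unfold nearPart
      have hcases : j = k - 1 ∨ j = k ∨ j = k + 1 := by omega
      rcases hcases with rfl | rfl | rfl <;> rw [indicator_of_mem hj]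
      · exact le_self_add
      · exact le_add_left le_self_add
      · exact le_add_left le_add_self
  calc (volume (Metric.ball c ρ))⁻¹ * ∫⁻ y in Metric.ball c ρ, f y
      ≤ (volume (Metric.ball c ρ))⁻¹ *
          ∫⁻ y in Metric.ball c ρ, (nearPart f k y + ∑' j, far j y) :=
        mul_le_mul_right (lintegral_mono_ae (ae_restrict_of_ae hpt)) _
    _ = (volume (Metric.ball c ρ))⁻¹ * (∫⁻ y in Metric.ball c ρ, nearPart f k y) +
          ∑' j, (volume (Metric.ball c ρ))⁻¹ * ∫⁻ y in Metric.ball c ρ, far j y := by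
        rw [lintegral_add_left (measurable_nearPart hf k),
          lintegral_tsum fun j => (hfarm j).aemeasurable, mul_add, ENNReal.tsum_mul_left]
    _ ≤ _ := by
        refine add_le_add (le_iSup₂_of_le c ρ (le_iSup₂_of_le hρ hxB le_rfl)) ?_
        rw [farSum, ← ENNReal.tsum_mul_left]
        refine ENNReal.tsum_le_tsum fun j => ?_
        by_cases h : j + 2 ≤ k ∨ k + 2 ≤ j
        · simp only [hfar, if_pos h]
          exact inv_volume_ball_mul_setLIntegral_annulus_le h f hx hxB
        · simp [hfar, if_neg h]

lemma setLIntegral_ball_le_farSum (hn : 0 < n) {f : Euc n → ℝ≥0∞} (hf : Measurable f) (k : ℤ) :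
    ∫⁻ y in Metric.ball 0 ((2 : ℝ) ^ k), f y ≤ 2 ^ ((k : ℝ) * n) * farSum f k := by
  have hpt : ∀ᵐ y : Euc n, f y ≤ ∑' j : ℤ, (annulus n j).indicator f y := by
    filter_upwards [ae_ne_zero_euc hn] with y hy
    obtain ⟨j, hj⟩ := exists_mem_annulus hy
    refine le_trans (le_of_eq ?_) (ENNReal.le_tsum j)
    rw [indicator_of_mem hj]
  refine (lintegral_mono_ae (ae_restrict_of_ae hpt)).trans ?_
  rw [lintegral_tsum fun j => (hf.indicator (measurableSet_annulus n j)).aemeasurable, farSum,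
    ← ENNReal.tsum_mul_left]
  refine ENNReal.tsum_le_tsum fun j => ?_
  rw [setLIntegral_indicator (measurableSet_annulus n j)]
  rcases le_or_gt j k with h | h
  · rw [max_eq_right (by exact_mod_cast h), ← mul_assoc, ← two_rpow_add, add_neg_cancel,
      ENNReal.rpow_zero, one_mul]
    exact lintegral_mono_set inter_subset_left
  · have hempty : annulus n j ∩ Metric.ball 0 ((2 : ℝ) ^ k) = ∅ := by
      rw [← not_nonempty_iff_eq_empty]
      rintro ⟨y, hy, hyB⟩
      have h1 := (mem_annulus.1 hy).2
      have h2 : ‖y‖ < (2 : ℝ) ^ k := by simpa using hyB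
      have h3 : (2 : ℝ) ^ k ≤ 2 ^ (j - 1) := zpow_le_zpow_right₀ one_le_two (by omega)
      linarith
    rw [hempty]
    simp

/-- The weighted norm of `f` on the annulus `C_k`. -/
def herzTerm (r q α : ℝ) (f : Euc n → ℝ≥0∞) (k : ℤ) : ℝ≥0∞ :=
  2 ^ ((k : ℝ) * α) * lorentzNorm r q ((annulus n k).indicator f)

lemma herzNorm_eq_tsum_herzTerm {α p : ℝ} (hp : 0 < p) (f : Euc n → ℝ≥0∞) :
    herzNorm (lorentzNorm r q) α p f = (∑' k : ℤ, herzTerm r q α f k ^ p) ^ (1 / p) := by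
  unfold herzNorm herzTerm
  congr 1
  refine tsum_congr fun k => ?_
  rw [ENNReal.mul_rpow_of_nonneg _ _ hp.le, ← ENNReal.rpow_mul]
  congr 2
  ring

lemma exists_farSum_le (hr : 1 < r) (hq : 0 < q) {α δ : ℝ} (hδ1 : δ ≤ n / r + α)
    (hδ2 : δ ≤ n * (1 - 1 / r) - α) :
    ∃ C : ℝ≥0∞, C ≠ ∞ ∧ ∀ f : Euc n → ℝ≥0∞, Measurable f → ∀ k : ℤ,
      2 ^ ((k : ℝ) * α) * (2 ^ ((k : ℝ) * n * (1 / r)) * farSum f k) ≤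
        C * ∑' j : ℤ, (2 : ℝ≥0∞) ^ (-δ * |((j - k : ℤ) : ℝ)|) * herzTerm r q α f j := by
  obtain ⟨C, hC, hle⟩ := exists_lintegral_le_lorentzNorm (n := n) hr hq
  set v := volume (Metric.ball (0 : Euc n) 1)
  have hv0 : v ≠ 0 := volume_unit_ball_ne_zero n
  have hvt : v ≠ ∞ := measure_ball_lt_top.ne
  refine ⟨C * v ^ (1 - 1 / r), ENNReal.mul_ne_top hC
    (by simp [ENNReal.rpow_eq_top_iff, hv0, hvt]), fun f hf k => ?_⟩
  rw [farSum, ← ENNReal.tsum_mul_left, ← ENNReal.tsum_mul_left, ← ENNReal.tsum_mul_left]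
  refine ENNReal.tsum_le_tsum fun j => ?_
  have hsub : annulus n j ⊆ Metric.ball 0 ((2 : ℝ) ^ j) := sdiff_subset
  have hI : ∫⁻ y in annulus n j, f y ≤ C * (v ^ (1 - 1 / r) *
      2 ^ ((j : ℝ) * n * (1 - 1 / r)) * lorentzNorm r q ((annulus n j).indicator f)) := by
    have h := hle ((annulus n j).indicator f) (Metric.ball 0 ((2 : ℝ) ^ j))
      (hf.indicator (measurableSet_annulus n j)) (Metric.measure_ball_pos _ _ (by positivity)).ne'
      measure_ball_lt_top.ne
    rw [setLIntegral_indicator (measurableSet_annulus n j),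
      inter_eq_left.2 hsub, volume_ball_two_zpow,
      ENNReal.mul_rpow_of_ne_zero (two_rpow_ne_zero _) hv0, ← ENNReal.rpow_mul] at h
    rwa [mul_comm (v ^ _)]
  have hexp : (k : ℝ) * α + ((k : ℝ) * n * (1 / r) + (-(max (j : ℝ) k * n) +
      (j : ℝ) * n * (1 - 1 / r))) ≤ -δ * |((j - k : ℤ) : ℝ)| + j * α := by
    push_cast
    have hnr : (n : ℝ) / r = n * (1 / r) := by ring
    rw [hnr] at hδ1
    rcases le_total (j : ℝ) k with h | h
    · rw [max_eq_right h, abs_of_nonpos (by linarith)]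
      nlinarith [mul_le_mul_of_nonneg_right hδ2 (sub_nonneg.2 h)]
    · rw [max_eq_left h, abs_of_nonneg (by linarith)]
      nlinarith [mul_le_mul_of_nonneg_right hδ1 (sub_nonneg.2 h)]
  set N := lorentzNorm r q ((annulus n j).indicator f) with hN
  calc (2 : ℝ≥0∞) ^ ((k : ℝ) * α) * (2 ^ ((k : ℝ) * n * (1 / r)) *
        (2 ^ (-(max (j : ℝ) k * n)) * ∫⁻ y in annulus n j, f y))
      ≤ 2 ^ ((k : ℝ) * α) * (2 ^ ((k : ℝ) * n * (1 / r)) *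
        (2 ^ (-(max (j : ℝ) k * n)) * (C * (v ^ (1 - 1 / r) *
          2 ^ ((j : ℝ) * n * (1 - 1 / r)) * N)))) := by gcongr
    _ = C * v ^ (1 - 1 / r) * (2 ^ ((k : ℝ) * α + ((k : ℝ) * n * (1 / r) +
          (-(max (j : ℝ) k * n) + (j : ℝ) * n * (1 - 1 / r)))) * N) := by
        rw [two_rpow_add, two_rpow_add, two_rpow_add]
        ring
    _ ≤ C * v ^ (1 - 1 / r) * (2 ^ (-δ * |((j - k : ℤ) : ℝ)| + j * α) * N) := by
        gcongr
        exact one_le_two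
    _ = _ := by
        rw [herzTerm, two_rpow_add, ← hN]
        ring

lemma two_rpow_mul_lorentzNorm_adjacent_le {α δ : ℝ} (hδ : 0 < δ) (f : Euc n → ℝ≥0∞) {j k : ℤ}
    (hjk : |j - k| ≤ 1) :
    2 ^ ((k : ℝ) * α) * lorentzNorm r q ((annulus n j).indicator f) ≤
      2 ^ (|α| + δ) *
        ∑' j : ℤ, (2 : ℝ≥0∞) ^ (-δ * |((j - k : ℤ) : ℝ)|) * herzTerm r q α f j := by
  refine le_trans ?_ (mul_le_mul_right (ENNReal.le_tsum j) _)
  rw [herzTerm, ← mul_assoc, ← mul_assoc, ← two_rpow_add, ← two_rpow_add]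
  refine mul_le_mul_left (two_rpow_le_two_rpow ?_) _
  have h1 : |((j - k : ℤ) : ℝ)| ≤ 1 := by exact_mod_cast hjk
  have h2 : -(((j - k : ℤ) : ℝ) * α) ≤ |α| := by
    refine (neg_le_abs _).trans ?_
    rw [abs_mul]
    exact mul_le_of_le_one_left (abs_nonneg _) h1
  push_cast at h2 ⊢
  push_cast at h1
  nlinarith

/-- The weighted norms of `M f` on annuli are controlled by a convolution of those of `f`. -/
lemma exists_herzTerm_maximalFn_le (hn : 0 < n) (hr : 1 < r) (hq : 0 < q) {α δ : ℝ} (hδ : 0 < δ)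
    (hδ1 : δ ≤ n / r + α) (hδ2 : δ ≤ n * (1 - 1 / r) - α) :
    ∃ C : ℝ≥0∞, C ≠ ∞ ∧ ∀ f : Euc n → ℝ≥0∞, Measurable f → ∀ k : ℤ,
      herzTerm r q α (maximalFn f) k ≤
        C * ∑' j : ℤ, (2 : ℝ≥0∞) ^ (-δ * |((j - k : ℤ) : ℝ)|) * herzTerm r q α f j := by
  have hr0 : 0 < r := by linarith
  obtain ⟨Q, hQ, hadd⟩ := exists_lorentzNorm_add_le (n := n) hr0 hq
  obtain ⟨D, hD, hmax⟩ := exists_lorentzNorm_maximalFn_le hn hr hq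
  obtain ⟨F, hF, hfar⟩ := exists_farSum_le (n := n) hr hq hδ1 hδ2
  set v := volume (Metric.ball (0 : Euc n) 1)
  have hv0 : v ≠ 0 := volume_unit_ball_ne_zero n
  have hvt : v ≠ ∞ := measure_ball_lt_top.ne
  set K : ℝ≥0∞ := (2 ^ ((-3 : ℝ) * n) * v)⁻¹
  have hKt : K ≠ ∞ := ENNReal.inv_ne_top.2 (mul_ne_zero (two_rpow_ne_zero _) hv0)
  set c := ENNReal.ofReal (1 / (q / r)) ^ (1 / q)
  have hct : c ≠ ∞ := ENNReal.rpow_ne_top_of_nonneg (by positivity) ofReal_ne_top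
  have hvr : v ^ (1 / r) ≠ ∞ := ENNReal.rpow_ne_top_of_nonneg (by positivity) hvt
  set E : ℝ≥0∞ := 2 ^ (|α| + δ)
  have hE : E ≠ ∞ := two_rpow_ne_top _
  refine ⟨Q * (D * (Q * (E + Q * (E + E))) + c * (K * v ^ (1 / r) * F)), by finiteness,
    fun f hf k => ?_⟩
  set T := ∑' j : ℤ, (2 : ℝ≥0∞) ^ (-δ * |((j - k : ℤ) : ℝ)|) * herzTerm r q α f j
  set w : ℝ≥0∞ := 2 ^ ((k : ℝ) * α)
  set N : ℤ → ℝ≥0∞ := fun j => lorentzNorm r q ((annulus n j).indicator f)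
  have hadj : ∀ j : ℤ, |j - k| ≤ 1 → w * N j ≤ E * T := fun j hj =>
    two_rpow_mul_lorentzNorm_adjacent_le hδ f hj
  have hnear : lorentzNorm r q (nearPart f k) ≤ Q * (N (k - 1) + Q * (N k + N (k + 1))) :=
    (hadd _ _).trans (mul_le_mul_right (add_le_add_right (hadd _ _) _) _)
  have hpt : ∀ x, (annulus n k).indicator (maximalFn f) x ≤
      maximalFn (nearPart f k) x + (annulus n k).indicator (fun _ => K * farSum f k) x := by
    intro x
    by_cases hx : x ∈ annulus n k
    · rw [indicator_of_mem hx, indicator_of_mem hx]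
      exact maximalFn_le_nearPart_add_farSum hn hf hx
    · rw [indicator_of_notMem hx]
      exact zero_le
  have hvol : volume (annulus n k) ^ (1 / r) ≤ 2 ^ ((k : ℝ) * n * (1 / r)) * v ^ (1 / r) := by
    refine (ENNReal.rpow_le_rpow (measure_mono sdiff_subset) (by positivity)).trans ?_
    rw [volume_ball_two_zpow, ENNReal.mul_rpow_of_nonneg _ _ (by positivity), ← ENNReal.rpow_mul]
  calc herzTerm r q α (maximalFn f) k
      ≤ w * (Q * (lorentzNorm r q (maximalFn (nearPart f k)) +
          lorentzNorm r q ((annulus n k).indicator fun _ => K * farSum f k))) :=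
        mul_le_mul_right ((lorentzNorm_mono hq hpt).trans (hadd _ _)) _
    _ ≤ w * (Q * (D * (Q * (N (k - 1) + Q * (N k + N (k + 1)))) +
          c * (K * farSum f k * (2 ^ ((k : ℝ) * n * (1 / r)) * v ^ (1 / r))))) := by
        gcongr
        · exact (hmax _ (measurable_nearPart hf k)).trans (mul_le_mul_right hnear _)
        · exact (lorentzNorm_indicator_const_le hr0 hq _ _).trans
            (mul_le_mul_right (mul_le_mul_right hvol _) _)
    _ = Q * (D * (Q * (w * N (k - 1) + Q * (w * N k + w * N (k + 1)))) +
          c * (K * v ^ (1 / r) * (w * (2 ^ ((k : ℝ) * n * (1 / r)) * farSum f k)))) := by ring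
    _ ≤ Q * (D * (Q * (E * T + Q * (E * T + E * T))) + c * (K * v ^ (1 / r) * (F * T))) := by
        exact mul_le_mul_right (add_le_add (mul_le_mul_right (mul_le_mul_right (add_le_add
          (hadj _ (by simp)) (mul_le_mul_right (add_le_add (hadj _ (by simp)) (hadj _ (by simp)))
          _)) _) _) (mul_le_mul_right (mul_le_mul_right (hfar f hf k) _) _)) _
    _ = _ := by ring

end Herz

/-- Let `0 < p < ∞`, `1 < r < ∞`, `1 ≤ q < ∞` and
`−n/r < α < n/r' = n(1 − 1/r)`. Then the Hardy–Littlewood maximal operator is bounded on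
the Herz–Lorentz space `K̇^{α,p}_{r,q}(ℝⁿ)`. -/
theorem stmt17 {n : ℕ} (hn : 0 < n) (α p r q : ℝ) (hp : 0 < p) (hr : 1 < r) (hq : 1 ≤ q)
    (hα : -((n : ℝ) / r) < α ∧ α < (n : ℝ) * (1 - 1 / r)) :
    ∃ C : ℝ≥0∞, 0 < C ∧ C < ∞ ∧
      ∀ f : Euc n → ℝ≥0∞, Measurable f → herzNorm (lorentzNorm r q) α p f ≠ ∞ →
        (∀ (x : Euc n) (ρ : ℝ), 0 < ρ → ∫⁻ y in Metric.ball x ρ, f y ∂volume < ∞) ∧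
        herzNorm (lorentzNorm r q) α p (maximalFn f) ≤
          C * herzNorm (lorentzNorm r q) α p f := by
  have hr0 : 0 < r := by linarith
  have hq0 : 0 < q := by linarith
  set δ := min (n / r + α) (n * (1 - 1 / r) - α)
  have hδ : 0 < δ := lt_min (by linarith [hα.1]) (by linarith [hα.2])
  have hδ1 : δ ≤ n / r + α := min_le_left _ _
  have hδ2 : δ ≤ n * (1 - 1 / r) - α := min_le_right _ _
  obtain ⟨A, hA, hconv⟩ := exists_tsum_conv_rpow_le hδ hp
  obtain ⟨B, hB, hterm⟩ := exists_herzTerm_maximalFn_le hn hr hq0 hδ hδ1 hδ2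
  obtain ⟨F, hF, hfar⟩ := exists_farSum_le (n := n) hr hq0 hδ1 hδ2
  have hABt : B * A ^ (1 / p) ≠ ∞ :=
    ENNReal.mul_ne_top hB (ENNReal.rpow_ne_top_of_nonneg (by positivity) hA)
  refine ⟨B * A ^ (1 / p) + 1, by positivity, by finiteness, fun f hf hfin => ⟨fun x ρ hρ => ?_, ?_⟩⟩
  · obtain ⟨m, hm⟩ := pow_unbounded_of_one_lt (ρ + ‖x‖) one_lt_two
    have hsub : Metric.ball x ρ ⊆ Metric.ball 0 ((2 : ℝ) ^ (m : ℤ)) :=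
      Metric.ball_subset_ball' (by simpa using hm.le)
    have hsum : ∑' j : ℤ, herzTerm r q α f j ^ p ≠ ∞ := by
      intro htop
      rw [herzNorm_eq_tsum_herzTerm hp, htop, ENNReal.top_rpow_of_pos (by positivity)] at hfin
      exact hfin rfl
    have hT : ∑' j : ℤ, (2 : ℝ≥0∞) ^ (-δ * |((j - m : ℤ) : ℝ)|) * herzTerm r q α f j ≠ ∞ := by
      intro htop
      have h := (ENNReal.le_tsum (m : ℤ)).trans (hconv (herzTerm r q α f))
      rw [htop, ENNReal.top_rpow_of_pos hp, top_le_iff] at h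
      exact ENNReal.mul_ne_top hA hsum h
    have hfarfin : farSum f m ≠ ∞ := by
      intro htop
      have h := hfar f hf m
      rw [htop, ENNReal.mul_top (two_rpow_ne_zero _), ENNReal.mul_top (two_rpow_ne_zero _),
        top_le_iff] at h
      exact ENNReal.mul_ne_top hF hT h
    exact ((lintegral_mono_set hsub).trans (setLIntegral_ball_le_farSum hn hf m)).trans_lt
      (ENNReal.mul_lt_top (two_rpow_ne_top _).lt_top hfarfin.lt_top)
  · refine le_trans ?_ (mul_le_mul_left le_self_add _)
    rw [herzNorm_eq_tsum_herzTerm hp, herzNorm_eq_tsum_herzTerm hp]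
    calc (∑' k : ℤ, herzTerm r q α (maximalFn f) k ^ p) ^ (1 / p)
        ≤ (B ^ p * (A * ∑' j : ℤ, herzTerm r q α f j ^ p)) ^ (1 / p) := by
          refine ENNReal.rpow_le_rpow ?_ (by positivity)
          refine le_trans ?_ (mul_le_mul_right (hconv (herzTerm r q α f)) _)
          rw [← ENNReal.tsum_mul_left]
          refine ENNReal.tsum_le_tsum fun k => ?_
          rw [← ENNReal.mul_rpow_of_nonneg _ _ hp.le]
          exact ENNReal.rpow_le_rpow (hterm f hf k) hp.le
      _ = _ := by
          rw [ENNReal.mul_rpow_of_nonneg _ _ (by positivity),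
            ENNReal.mul_rpow_of_nonneg _ _ (by positivity), ← ENNReal.rpow_mul,
            mul_one_div_cancel hp.ne', ENNReal.rpow_one, mul_assoc]
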